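/- The set of positions of the game W_1 whose Sprague–Grundy value equals 1 is {(0,1), (1,0)} ∪ {(A_n + 2, B_n + 2) : n ≥ 0} ∪ {(B_n + 2, A_n + 2) : n ≥ 0}. -/

import Mathlib

noncomputable def phi : ℝ := (1 + Real.sqrt 5) / 2
noncomputable def wA (n : ℕ) : ℕ := ⌊phi * n⌋₊
noncomputable def wB (n : ℕ) : ℕ := ⌊phi ^ 2 * n⌋₊

/-- A legal move in the game `W_k` from `p` to `q`: a Nim move, or a diagonal move
whose resulting smaller entry is at least `k`. -/
def WkMove (k : ℕ) (p q : ℕ × ℕ) : Prop :=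
  (∃ t, 1 ≤ t ∧ t ≤ p.1 ∧ q = (p.1 - t, p.2)) ∨
  (∃ t, 1 ≤ t ∧ t ≤ p.2 ∧ q = (p.1, p.2 - t)) ∨
  (∃ s, 1 ≤ s ∧ s ≤ min p.1 p.2 ∧ k ≤ min (p.1 - s) (p.2 - s) ∧ q = (p.1 - s, p.2 - s))

/-- `S` is the set of P-positions of the game with move relation `move`. -/
def IsPPositions (move : ℕ × ℕ → ℕ × ℕ → Prop) (S : Set (ℕ × ℕ)) : Prop :=
  (∀ p ∈ S, ∀ q ∈ S, ¬ move p q) ∧ (∀ p ∉ S, ∃ q ∈ S, move p q)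

/-- `G` is the Sprague–Grundy function of the game with move relation `move`:
at every position, `G` takes the mex of the values of the options. -/
def IsGrundy (move : ℕ × ℕ → ℕ × ℕ → Prop) (G : ℕ × ℕ → ℕ) : Prop :=
  ∀ p, (∀ q, move p q → G q ≠ G p) ∧ (∀ v, v < G p → ∃ q, move p q ∧ G q = v)

theorem phi_sq : phi ^ 2 = phi + 1 := Real.goldenRatio_sq

theorem one_lt_phi : 1 < phi := Real.one_lt_goldenRatio

theorem phi_pos : 0 < phi := Real.goldenRatio_pos

theorem holderConjugate_phi_sq_phi : (phi ^ 2).HolderConjugate phi := by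
  have h := phi_pos
  rw [Real.holderConjugate_iff]
  refine ⟨by rw [phi_sq]; linarith, ?_⟩
  field_simp
  linarith [phi_sq]

theorem wA_zero : wA 0 = 0 := by simp [wA]

theorem wB_eq (n : ℕ) : wB n = wA n + n := by
  have h := mul_nonneg phi_pos.le n.cast_nonneg
  rw [wB, wA, phi_sq, add_mul, one_mul, Nat.floor_add_natCast h]

theorem wA_strictMono : StrictMono wA := by
  refine strictMono_nat_of_lt_succ fun n => ?_
  have h := mul_nonneg phi_pos.le n.cast_nonneg
  rw [wA, wA, Nat.lt_iff_add_one_le, ← Nat.floor_add_one h]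
  refine Nat.floor_le_floor ?_
  push_cast
  linarith [one_lt_phi]

theorem beattySeq_phi (n : ℕ) : beattySeq phi n = wA n := by
  have h := mul_nonneg phi_pos.le n.cast_nonneg
  rw [wA, beattySeq, Int.natCast_floor_eq_floor h, mul_comm]
  simp

theorem beattySeq_phi_sq (n : ℕ) : beattySeq (phi ^ 2) n = wB n := by
  have h := mul_nonneg (sq_nonneg phi) n.cast_nonneg
  rw [wB, beattySeq, Int.natCast_floor_eq_floor h, mul_comm]
  simp

theorem mem_beattySeq_phi_pos {j : ℕ} :
    (j : ℤ) ∈ {beattySeq phi k | k > 0} ↔ ∃ n > 0, wA n = j := by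
  constructor
  · rintro ⟨k, hk, h⟩
    lift k to ℕ using hk.le
    exact ⟨k, by exact_mod_cast hk, by rw [beattySeq_phi] at h; exact_mod_cast h⟩
  · rintro ⟨n, hn, rfl⟩
    exact ⟨n, by exact_mod_cast hn, beattySeq_phi n⟩

theorem mem_beattySeq_phi_sq_pos {j : ℕ} :
    (j : ℤ) ∈ {beattySeq (phi ^ 2) k | k > 0} ↔ ∃ n > 0, wB n = j := by
  constructor
  · rintro ⟨k, hk, h⟩
    lift k to ℕ using hk.le
    exact ⟨k, by exact_mod_cast hk, by rw [beattySeq_phi_sq] at h; exact_mod_cast h⟩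
  · rintro ⟨n, hn, rfl⟩
    exact ⟨n, by exact_mod_cast hn, beattySeq_phi_sq n⟩

theorem wythoff_partition (j : ℕ) (hj : 0 < j) :
    Xor (∃ n > 0, wA n = j) (∃ n > 0, wB n = j) := by
  have h := Irrational.beattySeq_symmDiff_beattySeq_pos holderConjugate_phi_sq_phi.symm
    Real.goldenRatio_irrational
  have hj' : (j : ℤ) ∈ {n : ℤ | 0 < n} := by simpa using hj
  rw [← h, Set.mem_symmDiff] at hj'
  rwa [mem_beattySeq_phi_pos, mem_beattySeq_phi_sq_pos] at hj'

theorem exists_wA_or_wB (j : ℕ) : (∃ n, wA n = j) ∨ ∃ n, wB n = j := by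
  rcases Nat.eq_zero_or_pos j with rfl | hj
  · exact Or.inl ⟨0, wA_zero⟩
  · rcases wythoff_partition j hj with ⟨⟨n, -, h⟩, -⟩ | ⟨⟨n, -, h⟩, -⟩
    exacts [Or.inl ⟨n, h⟩, Or.inr ⟨n, h⟩]

theorem wA_eq_wB {m n : ℕ} (h : wA m = wB n) : m = 0 ∧ n = 0 := by
  have hm := wA_strictMono.le_apply (x := m)
  have hn := wB_eq n
  by_cases hj : wA m = 0
  · omega
  have hm0 : 0 < m := by
    by_contra h0
    obtain rfl : m = 0 := by omega
    exact hj wA_zero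
  have hn0 : 0 < n := by
    by_contra h0
    obtain rfl : n = 0 := by omega
    rw [wA_zero] at hn
    omega
  rcases wythoff_partition (wA m) (by omega) with ⟨-, h'⟩ | ⟨-, h'⟩
  · exact (h' ⟨n, hn0, h.symm⟩).elim
  · exact (h' ⟨m, hm0, rfl⟩).elim

/-- The P-positions of Wythoff's game. -/
def IsWythoffPair (x y : ℕ) : Prop :=
  (∃ n, x = wA n ∧ y = wB n) ∨ ∃ n, x = wB n ∧ y = wA n

theorem IsWythoffPair.symm {x y : ℕ} (h : IsWythoffPair x y) : IsWythoffPair y x := by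
  rcases h with ⟨n, h₁, h₂⟩ | ⟨n, h₁, h₂⟩
  exacts [Or.inr ⟨n, h₂, h₁⟩, Or.inl ⟨n, h₂, h₁⟩]

theorem IsWythoffPair.right_unique {x y y' : ℕ} (h : IsWythoffPair x y)
    (h' : IsWythoffPair x y') : y = y' := by
  rcases h with ⟨n, rfl, rfl⟩ | ⟨n, rfl, rfl⟩ <;> rcases h' with ⟨m, h, rfl⟩ | ⟨m, h, rfl⟩
  · rw [wA_strictMono.injective h]
  · obtain ⟨rfl, rfl⟩ := wA_eq_wB h
    exact h.symm
  · obtain ⟨rfl, rfl⟩ := wA_eq_wB h.symm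
    exact h.symm
  · have hnm : n = m := by
      rw [wB_eq, wB_eq] at h
      rcases lt_trichotomy n m with hlt | heq | hlt
      · have := wA_strictMono hlt; omega
      · exact heq
      · have := wA_strictMono hlt; omega
    rw [hnm]

theorem IsWythoffPair.left_unique {x x' y : ℕ} (h : IsWythoffPair x y)
    (h' : IsWythoffPair x' y) : x = x' :=
  h.symm.right_unique h'.symm

theorem IsWythoffPair.diag_unique {x y x' y' : ℕ} (h : IsWythoffPair x y)
    (h' : IsWythoffPair x' y') (hd : x + y' = x' + y) : x = x' := by
  rcases h with ⟨n, rfl, rfl⟩ | ⟨n, rfl, rfl⟩ <;> rcases h' with ⟨m, rfl, rfl⟩ | ⟨m, rfl, rfl⟩ <;>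
    rw [wB_eq, wB_eq] at * <;> obtain rfl : n = m := by omega
  all_goals omega

theorem IsWythoffPair.exists_of_not_of_le {x y : ℕ} (h : ¬IsWythoffPair x y) (hxy : x ≤ y) :
    (∃ y' < y, IsWythoffPair x y') ∨
      ∃ x' < x, ∃ y' < y, x + y' = x' + y ∧ IsWythoffPair x' y' := by
  rcases exists_wA_or_wB x with ⟨n, rfl⟩ | ⟨n, rfl⟩
  · have hB := wB_eq n
    rcases lt_trichotomy y (wB n) with hlt | rfl | hlt
    · right
      have hd := wA_strictMono (show y - wA n < n by omega)
      have hBd := wB_eq (y - wA n)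
      exact ⟨_, hd, wB (y - wA n), by omega, by omega, Or.inl ⟨_, rfl, rfl⟩⟩
    · exact (h (Or.inl ⟨n, rfl, rfl⟩)).elim
    · exact Or.inl ⟨_, hlt, Or.inl ⟨n, rfl, rfl⟩⟩
  · have hB := wB_eq n
    refine Or.inl ⟨wA n, lt_of_le_of_ne (by omega) ?_, Or.inr ⟨n, rfl, rfl⟩⟩
    rintro rfl
    exact h (Or.inr ⟨n, rfl, rfl⟩)

theorem IsWythoffPair.exists_of_not {x y : ℕ} (h : ¬IsWythoffPair x y) :
    (∃ y' < y, IsWythoffPair x y') ∨ (∃ x' < x, IsWythoffPair x' y) ∨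
      ∃ x' < x, ∃ y' < y, x + y' = x' + y ∧ IsWythoffPair x' y' := by
  rcases le_total x y with hxy | hxy
  · rcases exists_of_not_of_le h hxy with h | h
    exacts [Or.inl h, Or.inr (Or.inr h)]
  · rcases exists_of_not_of_le (fun h' => h h'.symm) hxy with
      ⟨x', hx, h⟩ | ⟨y', hy, x', hx, hd, h⟩
    · exact Or.inr (Or.inl ⟨x', hx, h.symm⟩)
    · exact Or.inr (Or.inr ⟨x', hx, y', hy, by omega, h.symm⟩)

theorem wkMove_mk {k a b c d : ℕ} : WkMove k (a, b) (c, d) ↔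
    (c < a ∧ d = b) ∨ (c = a ∧ d < b) ∨ (c < a ∧ d < b ∧ a + d = c + b ∧ k ≤ c ∧ k ≤ d) := by
  simp only [WkMove, Prod.mk.injEq]
  constructor
  · rintro (⟨t, h⟩ | ⟨t, h⟩ | ⟨s, h⟩) <;> omega
  · rintro (h | h | h)
    · exact Or.inl ⟨a - c, by omega⟩
    · exact Or.inr (Or.inl ⟨b - d, by omega⟩)
    · exact Or.inr (Or.inr ⟨a - c, by omega⟩)

/-- Wythoff's P-positions, translated by `c` along the diagonal. -/
def wythoffShift (c : ℕ) : Set (ℕ × ℕ) :=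
  {p | c ≤ p.1 ∧ c ≤ p.2 ∧ IsWythoffPair (p.1 - c) (p.2 - c)}

theorem wythoffShift_not_move {c k : ℕ} {p q : ℕ × ℕ} (hp : p ∈ wythoffShift c)
    (hq : q ∈ wythoffShift c) : ¬WkMove k p q := by
  obtain ⟨a, b⟩ := p
  obtain ⟨a', b'⟩ := q
  obtain ⟨ha, hb, h⟩ := hp
  obtain ⟨ha', hb', h'⟩ := hq
  simp only at ha hb h ha' hb' h'
  rw [wkMove_mk]
  rintro (⟨hlt, rfl⟩ | ⟨rfl, hlt⟩ | ⟨hlt, -, hd, -⟩)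
  · have := h.left_unique h'; omega
  · have := h.right_unique h'; omega
  · have := h.diag_unique h' (by omega); omega

theorem wythoffShift_exists_move {c k a b : ℕ} (hk : k ≤ c) (ha : c ≤ a) (hb : c ≤ b)
    (h : (a, b) ∉ wythoffShift c) : ∃ q ∈ wythoffShift c, WkMove k (a, b) q := by
  have h' : ¬IsWythoffPair (a - c) (b - c) := fun hw => h ⟨ha, hb, hw⟩
  rcases IsWythoffPair.exists_of_not h' with ⟨y, hy, hw⟩ | ⟨x, hx, hw⟩ | ⟨x, hx, y, hy, hd, hw⟩
  · exact ⟨(a, y + c), ⟨ha, by simp, by simpa using hw⟩, by rw [wkMove_mk]; omega⟩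
  · exact ⟨(x + c, b), ⟨by simp, hb, by simpa using hw⟩, by rw [wkMove_mk]; omega⟩
  · exact ⟨(x + c, y + c), ⟨by simp, by simp, by simpa using hw⟩, by rw [wkMove_mk]; omega⟩

theorem WkMove.sum_lt {k : ℕ} {p q : ℕ × ℕ} (h : WkMove k p q) : q.1 + q.2 < p.1 + p.2 := by
  obtain ⟨a, b⟩ := p
  obtain ⟨c, d⟩ := q
  rw [wkMove_mk] at h
  simp only
  omega

/-- A stable set of positions of value at least `v`, reachable from every other position of
value `v`, is the set of all positions of value `v`. -/
theorem IsGrundy.setOf_eq {k v : ℕ} {G : ℕ × ℕ → ℕ} (hG : IsGrundy (WkMove k) G)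
    {S : Set (ℕ × ℕ)} (hle : ∀ p ∈ S, v ≤ G p) (hstable : ∀ p ∈ S, ∀ q ∈ S, ¬WkMove k p q)
    (habs : ∀ p ∉ S, G p = v → ∃ q ∈ S, WkMove k p q) : {p | G p = v} = S := by
  suffices ∀ n, ∀ p : ℕ × ℕ, p.1 + p.2 = n → (G p = v ↔ p ∈ S) from
    Set.ext fun p => this _ p rfl
  intro n
  induction n using Nat.strong_induction_on with
  | _ n ih =>
    rintro p rfl
    constructor
    · intro hp
      by_contra hpS
      obtain ⟨q, hq, hm⟩ := habs p hpS hp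
      exact (hG p).1 q hm (((ih _ hm.sum_lt q rfl).2 hq).trans hp.symm)
    · intro hp
      by_contra hne
      obtain ⟨q, hm, hq⟩ := (hG p).2 v (lt_of_le_of_ne (hle p hp) (Ne.symm hne))
      exact hstable p hp q ((ih _ hm.sum_lt q rfl).1 hq) hm

theorem W1_grundy_zero (G : ℕ × ℕ → ℕ) (hG : IsGrundy (WkMove 1) G) :
    {p : ℕ × ℕ | G p = 0} = {(0, 0)} ∪ wythoffShift 1 := by
  refine hG.setOf_eq (fun _ _ => Nat.zero_le _) ?_ ?_
  · rintro ⟨a, b⟩ hp ⟨c, d⟩ hq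
    rcases hp with hp | hp <;> rcases hq with hq | hq
    · simp only [Set.mem_singleton_iff, Prod.mk.injEq] at hp hq
      rw [wkMove_mk]; omega
    · simp only [Set.mem_singleton_iff, Prod.mk.injEq] at hp
      rw [wkMove_mk]; omega
    · simp only [Set.mem_singleton_iff, Prod.mk.injEq] at hq
      have h₁ := hp.1
      have h₂ := hp.2.1
      simp only at h₁ h₂
      rw [wkMove_mk]; omega
    · exact wythoffShift_not_move hp hq
  · rintro ⟨a, b⟩ hp -
    by_cases hab : 1 ≤ a ∧ 1 ≤ b
    · obtain ⟨q, hq, hm⟩ :=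
        wythoffShift_exists_move le_rfl hab.1 hab.2 fun h => hp (Or.inr h)
      exact ⟨q, Or.inr hq, hm⟩
    · have h0 : ¬(a = 0 ∧ b = 0) := fun h => hp (Or.inl (by simp [h]))
      exact ⟨(0, 0), Or.inl rfl, by rw [wkMove_mk]; omega⟩

theorem isWythoffPair_zero_zero : IsWythoffPair 0 0 :=
  Or.inl ⟨0, wA_zero.symm, by rw [wB_eq, wA_zero]⟩

theorem W1_grundy_one_eq_wythoffShift (G : ℕ × ℕ → ℕ) (hG : IsGrundy (WkMove 1) G) :
    {p : ℕ × ℕ | G p = 1} = {(0, 1), (1, 0)} ∪ wythoffShift 2 := by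
  have hzero (p : ℕ × ℕ) : G p = 0 ↔ p ∈ ({(0, 0)} ∪ wythoffShift 1 : Set (ℕ × ℕ)) :=
    Set.ext_iff.1 (W1_grundy_zero G hG) p
  have h11 : G (1, 1) = 0 := (hzero _).2 (Or.inr ⟨le_rfl, le_rfl, isWythoffPair_zero_zero⟩)
  have h00 : G (0, 0) = 0 := (hzero _).2 (Or.inl rfl)
  refine hG.setOf_eq ?_ ?_ ?_
  · rintro ⟨a, b⟩ hp
    rw [Nat.one_le_iff_ne_zero, Ne, hzero]
    rintro (h | ⟨ha, hb, hw⟩)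
    · rcases hp with (hp | hp) | hp
      · simp_all
      · simp_all
      · have := hp.1
        simp_all
    · rcases hp with (hp | hp) | ⟨ha', hb', hw'⟩
      · simp_all
      · simp_all
      · simp only at ha hb hw ha' hb' hw'
        have := hw.diag_unique hw' (by omega)
        omega
  · rintro ⟨a, b⟩ hp ⟨c, d⟩ hq
    by_cases hpq : (a, b) ∈ wythoffShift 2 ∧ (c, d) ∈ wythoffShift 2
    · exact wythoffShift_not_move hpq.1 hpq.2
    · simp only [Set.mem_union, Set.mem_insert_iff, Set.mem_singleton_iff, Prod.mk.injEq] at hp hq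
      have h₁ : (a, b) ∈ wythoffShift 2 → 2 ≤ a ∧ 2 ≤ b := fun h => ⟨h.1, h.2.1⟩
      have h₂ : (c, d) ∈ wythoffShift 2 → 2 ≤ c ∧ 2 ≤ d := fun h => ⟨h.1, h.2.1⟩
      rw [wkMove_mk]
      by_cases h₃ : (a, b) ∈ wythoffShift 2 <;> by_cases h₄ : (c, d) ∈ wythoffShift 2 <;>
        simp only [h₃, h₄, true_implies, or_true, or_false, and_self, not_true_eq_false] at * <;>
        omega
  · rintro ⟨a, b⟩ hp hG1
    by_cases hab : 2 ≤ a ∧ 2 ≤ b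
    · obtain ⟨q, hq, hm⟩ :=
        wythoffShift_exists_move one_le_two hab.1 hab.2 fun h => hp (Or.inr h)
      exact ⟨q, Or.inr hq, hm⟩
    · have n00 : ¬(a = 0 ∧ b = 0) := by
        rintro ⟨rfl, rfl⟩
        omega
      have n11 : ¬(a = 1 ∧ b = 1) := by
        rintro ⟨rfl, rfl⟩
        omega
      have n01 : ¬(a = 0 ∧ b = 1) := fun h => hp (Or.inl (by simp [h]))
      have n10 : ¬(a = 1 ∧ b = 0) := fun h => hp (Or.inl (by simp [h]))
      by_cases hc : a = 0 ∨ b = 1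
      · exact ⟨(0, 1), Or.inl (by simp), by rw [wkMove_mk]; omega⟩
      · exact ⟨(1, 0), Or.inl (by simp), by rw [wkMove_mk]; omega⟩

theorem mem_wythoffShift {c : ℕ} {p : ℕ × ℕ} : p ∈ wythoffShift c ↔
    (∃ n, p = (wA n + c, wB n + c)) ∨ ∃ n, p = (wB n + c, wA n + c) := by
  obtain ⟨a, b⟩ := p
  simp only [Prod.mk.injEq]
  constructor
  · rintro ⟨ha, hb, ⟨n, h⟩ | ⟨n, h⟩⟩
    · exact Or.inl ⟨n, by simp only at *; omega⟩
    · exact Or.inr ⟨n, by simp only at *; omega⟩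
  · rintro (⟨n, rfl, rfl⟩ | ⟨n, rfl, rfl⟩)
    · exact ⟨by simp, by simp, Or.inl ⟨n, by simp⟩⟩
    · exact ⟨by simp, by simp, Or.inr ⟨n, by simp⟩⟩

theorem W1_grundy_one (G : ℕ × ℕ → ℕ) (hG : IsGrundy (WkMove 1) G) :
    {p : ℕ × ℕ | G p = 1} =
      ({((0 : ℕ), (1 : ℕ)), ((1 : ℕ), (0 : ℕ))} : Set (ℕ × ℕ)) ∪
      {p : ℕ × ℕ | ∃ n, p = (wA n + 2, wB n + 2)} ∪
      {p : ℕ × ℕ | ∃ n, p = (wB n + 2, wA n + 2)} := by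
  rw [W1_grundy_one_eq_wythoffShift G hG, Set.union_assoc]
  congr 1
  ext p
  exact mem_wythoffShift
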